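/- Let α, β, γ ∈ ℂ with α + β + γ = 0, let λ ∈ ℂ be nonzero, and let u be three times continuously differentiable on a connected open set U ⊆ ℂ⁴ with u_{34} ≠ 0 on U. If the Lax operators L₀ and M₀ commute on U (i.e. L₀(M₀f) = M₀(L₀f) for every twice continuously differentiable f : U → ℂ), then ∂₃(Φ/u_{34}) = 0 and ∂₄(Φ/u_{34}) = 0 on U; that is, Φ₄ − (u_{344}/u_{34})Φ = 0 and Φ₃ − (u_{343}/u_{34})Φ = 0 on U, so Φ/u_{34} is locally a function of z¹ and z² only. -/

import Mathlib

/-!  Coordinates: `z : Fin 4 → ℂ` with paper indices `z¹,z²,z³,z⁴` corresponding to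
`z 0, z 1, z 2, z 3`.  `pd i f` is the partial derivative ∂f/∂zⁱ. -/

/-- Partial derivative of `f : ℂ⁴ → ℂ` in the `i`-th coordinate direction. -/
noncomputable def pd (i : Fin 4) (f : (Fin 4 → ℂ) → ℂ) : (Fin 4 → ℂ) → ℂ :=
  fun z => fderiv ℂ f z (Pi.single i 1)

/-- The left-hand side Φ = α u₁₂u₃₄ + β u₁₃u₂₄ + γ u₁₄u₂₃ of the general heavenly
equation (paper indices 1,2,3,4 ↦ 0,1,2,3). -/
noncomputable def Phi (α β γ : ℂ) (u : (Fin 4 → ℂ) → ℂ) : (Fin 4 → ℂ) → ℂ :=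
  fun z => α * pd 0 (pd 1 u) z * pd 2 (pd 3 u) z
    + β * pd 0 (pd 2 u) z * pd 1 (pd 3 u) z
    + γ * pd 0 (pd 3 u) z * pd 1 (pd 2 u) z

/-- The Lax operator `X₁ f = u₃₄ f₁ − u₁₃ f₄ + γλ(u₃₄ f₁ − u₁₄ f₃)`. -/
noncomputable def X1 (γ lam : ℂ) (u f : (Fin 4 → ℂ) → ℂ) : (Fin 4 → ℂ) → ℂ :=
  fun z => pd 2 (pd 3 u) z * pd 0 f z - pd 0 (pd 2 u) z * pd 3 f z
    + γ * lam * (pd 2 (pd 3 u) z * pd 0 f z - pd 0 (pd 3 u) z * pd 2 f z)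

/-- The Lax operator `X₂ f = u₂₃ f₄ − u₃₄ f₂ + βλ(u₃₄ f₂ − u₂₄ f₃)`. -/
noncomputable def X2 (β lam : ℂ) (u f : (Fin 4 → ℂ) → ℂ) : (Fin 4 → ℂ) → ℂ :=
  fun z => pd 1 (pd 2 u) z * pd 3 f z - pd 2 (pd 3 u) z * pd 1 f z
    + β * lam * (pd 2 (pd 3 u) z * pd 1 f z - pd 1 (pd 3 u) z * pd 2 f z)

/-- `L₀ = (1/u₃₄) X₁`. -/
noncomputable def L0 (γ lam : ℂ) (u f : (Fin 4 → ℂ) → ℂ) : (Fin 4 → ℂ) → ℂ :=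
  fun z => X1 γ lam u f z / pd 2 (pd 3 u) z

/-- `M₀ = (1/u₃₄) X₂`. -/
noncomputable def M0 (β lam : ℂ) (u f : (Fin 4 → ℂ) → ℂ) : (Fin 4 → ℂ) → ℂ :=
  fun z => X2 β lam u f z / pd 2 (pd 3 u) z

theorem pd_contDiffOn {U : Set (Fin 4 → ℂ)} (hU : IsOpen U) {f : (Fin 4 → ℂ) → ℂ} {m n : WithTop ℕ∞}
    (hf : ContDiffOn ℂ n f U) (hmn : m + 1 ≤ n) (i : Fin 4) : ContDiffOn ℂ m (pd i f) U := by
  have h := hf.fderiv_of_isOpen hU hmn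
  exact h.clm_apply contDiffOn_const

theorem pd_comm {U : Set (Fin 4 → ℂ)} (hU : IsOpen U) {f : (Fin 4 → ℂ) → ℂ}
    (hf : ContDiffOn ℂ 2 f U) (i j : Fin 4) {z : Fin 4 → ℂ} (hz : z ∈ U) :
    pd i (pd j f) z = pd j (pd i f) z := by
  have hd : DifferentiableAt ℂ (fderiv ℂ f) z :=
    ((hf.fderiv_of_isOpen hU (m := 1) (by norm_num)).differentiableOn (by norm_num)).differentiableAt
      (hU.mem_nhds hz)
  have hs : IsSymmSndFDerivAt ℂ f z :=
    (hf.contDiffAt (hU.mem_nhds hz)).isSymmSndFDerivAt (by simp)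
  have key : ∀ a b : Fin 4, pd a (pd b f) z
      = fderiv ℂ (fderiv ℂ f) z (Pi.single a 1) (Pi.single b 1) := by
    intro a b
    unfold pd
    rw [fderiv_clm_apply hd (differentiableAt_const _)]
    simp
  rw [key, key]
  exact hs _ _

theorem pd_congr {U : Set (Fin 4 → ℂ)} (hU : IsOpen U) {f g : (Fin 4 → ℂ) → ℂ}
    (h : ∀ w ∈ U, f w = g w) (i : Fin 4) {z : Fin 4 → ℂ} (hz : z ∈ U) :
    pd i f z = pd i g z := by
  unfold pd
  rw [Filter.EventuallyEq.fderiv_eq (Filter.eventuallyEq_of_mem (hU.mem_nhds hz) h)]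

theorem pd_add {f g : (Fin 4 → ℂ) → ℂ} {z : Fin 4 → ℂ} (hf : DifferentiableAt ℂ f z)
    (hg : DifferentiableAt ℂ g z) (i : Fin 4) :
    pd i (fun w => f w + g w) z = pd i f z + pd i g z := by
  unfold pd
  rw [fderiv_fun_add hf hg]; rfl

theorem pd_mul {f g : (Fin 4 → ℂ) → ℂ} {z : Fin 4 → ℂ} (hf : DifferentiableAt ℂ f z)
    (hg : DifferentiableAt ℂ g z) (i : Fin 4) :
    pd i (fun w => f w * g w) z = f z * pd i g z + g z * pd i f z := by
  unfold pd
  rw [fderiv_fun_mul hf hg]; simp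

theorem pd_cmul {f : (Fin 4 → ℂ) → ℂ} {z : Fin 4 → ℂ} (hf : DifferentiableAt ℂ f z)
    (c : ℂ) (i : Fin 4) :
    pd i (fun w => c * f w) z = c * pd i f z := by
  unfold pd
  rw [fderiv_const_mul hf]; simp

theorem pd_div {f g : (Fin 4 → ℂ) → ℂ} {z : Fin 4 → ℂ} (hf : DifferentiableAt ℂ f z)
    (hg : DifferentiableAt ℂ g z) (h0 : g z ≠ 0) (i : Fin 4) :
    pd i (fun w => f w / g w) z = (pd i f z * g z - f z * pd i g z) / g z ^ 2 := by
  have h1 : DifferentiableAt ℂ (fun w => f w / g w) z := by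
    simp only [div_eq_mul_inv]; exact hf.fun_mul (hg.fun_inv h0)
  have h2 := pd_mul h1 hg i
  have h3 : pd i (fun w => f w / g w * g w) z = pd i f z := by
    have : (fun w => f w / g w * g w) =ᶠ[nhds z] f := by
      filter_upwards [hg.continuousAt.eventually_ne h0] with w hw
      field_simp
    unfold pd
    rw [this.fderiv_eq]
  rw [h3] at h2
  rw [h2]
  field_simp
  ring

theorem pd_coord (i j : Fin 4) : pd i (fun w => w j) = fun _ => if j = i then 1 else 0 := by
  funext z
  unfold pd
  have : (fun w : Fin 4 → ℂ => w j) = (ContinuousLinearMap.proj (R := ℂ) (φ := fun _ : Fin 4 => ℂ) j) := rfl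
  rw [this, ContinuousLinearMap.fderiv]
  simp [Pi.single_apply]

/-- if `λ ≠ 0`, `u` is C³ on a connected open set `U` with `u₃₄ ≠ 0` on `U`,
and the Lax operators `L₀`, `M₀` commute on every C² function on `U`, then
`∂₃(Φ/u₃₄) = 0` and `∂₄(Φ/u₃₄) = 0` on `U`; equivalently
`Φ₄ − (u₃₄₄/u₃₄)Φ = 0` and `Φ₃ − (u₃₄₃/u₃₄)Φ = 0` on `U`. -/
theorem commuting_lax_implies_Phi_over_u34_independent
    (U : Set (Fin 4 → ℂ)) (hU : IsOpen U) (hconn : IsConnected U)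
    (u : (Fin 4 → ℂ) → ℂ) (hu : ContDiffOn ℂ 3 u U)
    (h34 : ∀ z ∈ U, pd 2 (pd 3 u) z ≠ 0)
    (α β γ lam : ℂ) (hαβγ : α + β + γ = 0) (hlam : lam ≠ 0)
    (hcomm : ∀ f : (Fin 4 → ℂ) → ℂ, ContDiffOn ℂ 2 f U →
      ∀ z ∈ U, L0 γ lam u (M0 β lam u f) z = M0 β lam u (L0 γ lam u f) z) :
    ∀ z ∈ U,
      pd 2 (fun w => Phi α β γ u w / pd 2 (pd 3 u) w) z = 0 ∧
      pd 3 (fun w => Phi α β γ u w / pd 2 (pd 3 u) w) z = 0 ∧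
      pd 3 (Phi α β γ u) z
        - pd 2 (pd 3 (pd 3 u)) z / pd 2 (pd 3 u) z * Phi α β γ u z = 0 ∧
      pd 2 (Phi α β γ u) z
        - pd 2 (pd 3 (pd 2 u)) z / pd 2 (pd 3 u) z * Phi α β γ u z = 0 := by
  intro z hz
  have hd : ∀ i j, DifferentiableAt ℂ (pd i (pd j u)) z := fun i j =>
    ((pd_contDiffOn hU (pd_contDiffOn hU hu (m := 2) (by norm_num) j) (m := 1)
      (by norm_num) i).differentiableOn (by norm_num)).differentiableAt (hU.mem_nhds hz)
  have s12 : ∀ k i j, pd k (pd i (pd j u)) z = pd i (pd k (pd j u)) z := fun k i j =>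
    pd_comm hU (pd_contDiffOn hU hu (m := 2) (by norm_num) j) k i hz
  have s23 : ∀ k i j, pd k (pd i (pd j u)) z = pd k (pd j (pd i u)) z := fun k i j =>
    pd_congr hU (fun w hw => pd_comm hU (hu.of_le (by norm_num)) i j hw) k hz
  have hq := h34 z hz
  have e1 := hcomm (fun w => w 3) (by fun_prop) z hz
  have e2 := hcomm (fun w => w 2) (by fun_prop) z hz
  have M3 : M0 β lam u (fun w => w 3) = fun w => pd 1 (pd 2 u) w / pd 2 (pd 3 u) w := by
    funext w; simp [M0, X2, pd_coord]
  have L3 : L0 γ lam u (fun w => w 3) = fun w => (-1) * (pd 0 (pd 2 u) w / pd 2 (pd 3 u) w) := by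
    funext w; simp [L0, X1, pd_coord]; ring
  have M2 : M0 β lam u (fun w => w 2)
      = fun w => (-(β * lam)) * (pd 1 (pd 3 u) w / pd 2 (pd 3 u) w) := by
    funext w; simp [M0, X2, pd_coord]; ring
  have L2 : L0 γ lam u (fun w => w 2)
      = fun w => (-(γ * lam)) * (pd 0 (pd 3 u) w / pd 2 (pd 3 u) w) := by
    funext w; simp [L0, X1, pd_coord]; ring
  rw [M3, L3] at e1
  rw [M2, L2] at e2
  have dd : ∀ i j, DifferentiableAt ℂ (fun w => pd i (pd j u) w / pd 2 (pd 3 u) w) z :=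
    fun i j => by simp only [div_eq_mul_inv]; exact (hd i j).fun_mul ((hd 2 3).fun_inv hq)
  have pdd : ∀ k i j, pd k (fun w => pd i (pd j u) w / pd 2 (pd 3 u) w) z = _ :=
    fun k i j => pd_div (hd i j) (hd 2 3) hq k
  simp only [L0, X1, M0, X2, pd_cmul (dd _ _), pdd] at e1 e2
  have hPd : DifferentiableAt ℂ (Phi α β γ u) z := by
    have := hd
    unfold Phi
    fun_prop (disch := assumption)
  have hP : ∀ k, pd k (Phi α β γ u) z
      = α * (pd 0 (pd 1 u) z * pd k (pd 2 (pd 3 u)) z + pd 2 (pd 3 u) z * pd k (pd 0 (pd 1 u)) z)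
      + β * (pd 0 (pd 2 u) z * pd k (pd 1 (pd 3 u)) z + pd 1 (pd 3 u) z * pd k (pd 0 (pd 2 u)) z)
      + γ * (pd 0 (pd 3 u) z * pd k (pd 1 (pd 2 u)) z + pd 1 (pd 2 u) z * pd k (pd 0 (pd 3 u)) z) := by
    intro k
    have m := fun a b c d => (hd a b).fun_mul (hd c d)
    have e : Phi α β γ u = fun w => (α * (pd 0 (pd 1 u) w * pd 2 (pd 3 u) w)
      + β * (pd 0 (pd 2 u) w * pd 1 (pd 3 u) w))
      + γ * (pd 0 (pd 3 u) w * pd 1 (pd 2 u) w) := by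
      funext w; unfold Phi; ring
    rw [e, pd_add (((m _ _ _ _).const_mul _).fun_add ((m _ _ _ _).const_mul _))
      ((m _ _ _ _).const_mul _), pd_add ((m _ _ _ _).const_mul _) ((m _ _ _ _).const_mul _),
      pd_cmul (m _ _ _ _), pd_cmul (m _ _ _ _), pd_cmul (m _ _ _ _),
      pd_mul (hd _ _) (hd _ _), pd_mul (hd _ _) (hd _ _), pd_mul (hd _ _) (hd _ _)]
  have hα : α = -(β + γ) := by linear_combination hαβγ
  have a1 : pd 1 (pd 0 (pd 2 u)) z = pd 0 (pd 1 (pd 2 u)) z := s12 _ _ _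
  have a2 : pd 2 (pd 0 (pd 1 u)) z = pd 0 (pd 1 (pd 2 u)) z := by rw [s12, s23]
  have b1 : pd 2 (pd 0 (pd 3 u)) z = pd 0 (pd 2 (pd 3 u)) z := s12 _ _ _
  have b2 : pd 3 (pd 0 (pd 2 u)) z = pd 0 (pd 2 (pd 3 u)) z := by rw [s12, s23]
  have c1 : pd 2 (pd 1 (pd 3 u)) z = pd 1 (pd 2 (pd 3 u)) z := s12 _ _ _
  have c2 : pd 3 (pd 1 (pd 2 u)) z = pd 1 (pd 2 (pd 3 u)) z := by rw [s12, s23]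
  have d1 : pd 1 (pd 0 (pd 3 u)) z = pd 0 (pd 1 (pd 3 u)) z := s12 _ _ _
  have d2 : pd 3 (pd 0 (pd 1 u)) z = pd 0 (pd 1 (pd 3 u)) z := by rw [s12, s23]
  have f1 : pd 2 (pd 3 (pd 3 u)) z = pd 3 (pd 2 (pd 3 u)) z := s12 _ _ _
  have f2 : pd 2 (pd 3 (pd 2 u)) z = pd 2 (pd 2 (pd 3 u)) z := s23 _ _ _
  simp only [a1, a2, b1, b2, c1, c2, d1, d2] at e1 e2
  have g2 : pd 2 (Phi α β γ u) z * pd 2 (pd 3 u) z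
      - pd 2 (pd 2 (pd 3 u)) z * Phi α β γ u z = 0 := by
    rw [hP]
    simp only [a1, a2, b1, b2, c1, c2, d1, d2, Phi, hα]
    field_simp at e1
    apply mul_left_cancel₀ hlam
    linear_combination (-1) * e1
  have g3 : pd 3 (Phi α β γ u) z * pd 2 (pd 3 u) z
      - pd 3 (pd 2 (pd 3 u)) z * Phi α β γ u z = 0 := by
    rw [hP]
    simp only [a1, a2, b1, b2, c1, c2, d1, d2, Phi, hα]
    field_simp at e2
    apply mul_left_cancel₀ hlam
    linear_combination lam * e2
  rw [pd_div hPd (hd 2 3) hq, pd_div hPd (hd 2 3) hq, f1, f2]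
  refine ⟨?_, ?_, ?_, ?_⟩
  · rw [div_eq_zero_iff]; left; linear_combination g2
  · rw [div_eq_zero_iff]; left; linear_combination g3
  · field_simp; linear_combination g3
  · field_simp; linear_combination g2
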